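/- arXiv:1402.0072 — 2 statements merged into one kernel-verified Lean document; each statement's English description precedes it below -/
import Mathlib

section
/- Let Y and X be locally compact Hausdorff spaces with X paracompact, and let π : Y → X be a continuous open surjection. Then there exists a continuous function F : Y → [0,∞) such that (a) for every x ∈ X the restriction of F to the fiber π⁻¹(x) is not identically zero, and (b) for every compact set K ⊆ X the intersection of π⁻¹(K) with the closed support of F is compact. -/
/-- In a locally compact Hausdorff space every point has a nonnegative continuous function with
compact support which does not vanish at the point. -/
lemma exists_continuous_nonneg_hasCompactSupport_ne_zero {Y : Type*} [TopologicalSpace Y]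
    [LocallyCompactSpace Y] [T2Space Y] (y : Y) :
    ∃ f : Y → ℝ, Continuous f ∧ (∀ z, 0 ≤ f z) ∧ HasCompactSupport f ∧ f y ≠ 0 := by
  obtain ⟨f, hf1, -, hfc, hf⟩ := exists_continuous_one_zero_of_isCompact
    (isCompact_singleton (x := y)) isClosed_empty (Set.disjoint_empty _)
  refine ⟨f, f.continuous, fun z => (hf z).1, hfc, ?_⟩
  rw [hf1 (Set.mem_singleton y)]
  exact one_ne_zero

/-- The closed support of a locally finite sum lies in the union of the closed supports. -/
lemma LocallyFinite.tsupport_finsum_subset {ι Y M : Type*} [TopologicalSpace Y] [AddCommMonoid M]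
    {g : ι → Y → M} (hg : LocallyFinite fun i => Function.support (g i)) :
    tsupport (fun y => ∑ᶠ i, g i y) ⊆ ⋃ i, tsupport (g i) := by
  refine (closure_mono fun y hy => ?_).trans hg.closure_iUnion.subset
  by_contra hi
  exact hy (finsum_eq_zero_of_forall_eq_zero fun i =>
    not_not.1 fun h => hi (Set.mem_iUnion.2 ⟨i, h⟩))

/-- Bourbaki cutoff-function lemma. Let `Y` and `X` be locally compact
Hausdorff spaces with `X` paracompact, and let `p : Y → X` be a continuous open surjection.
Then there exists a continuous function `F : Y → [0,∞)` which is not identically zero on any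
fiber and whose closed support meets the preimage of any compact set in a compact set. -/
theorem statement0 {Y X : Type*} [TopologicalSpace Y] [LocallyCompactSpace Y] [T2Space Y]
    [TopologicalSpace X] [LocallyCompactSpace X] [T2Space X] [ParacompactSpace X]
    (p : Y → X) (hpc : Continuous p) (hpo : IsOpenMap p) (hps : Function.Surjective p) :
    ∃ F : Y → ℝ, Continuous F ∧ (∀ y, 0 ≤ F y) ∧
      (∀ x : X, ∃ y : Y, p y = x ∧ F y ≠ 0) ∧
      (∀ K : Set X, IsCompact K → IsCompact (p ⁻¹' K ∩ tsupport F)) := by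
  choose f hfc hf0 hfs hfne using
    exists_continuous_nonneg_hasCompactSupport_ne_zero (Y := Y)
  obtain ⟨ρ, hρ⟩ := PartitionOfUnity.exists_isSubordinate (s := (Set.univ : Set X)) isClosed_univ
    (fun y : Y => p '' Function.support (f y))
    (fun y => hpo _ ((hfc y).isOpen_support))
    (fun x _ => by
      obtain ⟨y, rfl⟩ := hps x
      exact Set.mem_iUnion.2 ⟨y, y, hfne y, rfl⟩)
  have hg0 (i y : Y) : 0 ≤ ρ i (p y) * f i y := mul_nonneg (ρ.nonneg i _) (hf0 i y)
  have hgρ (i : Y) : (Function.support fun y => ρ i (p y) * f i y) ⊆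
      p ⁻¹' Function.support (ρ i) := fun y hy => left_ne_zero_of_mul hy
  have hlf : LocallyFinite fun i : Y => Function.support fun y => ρ i (p y) * f i y :=
    (ρ.locallyFinite.preimage_continuous hpc).subset hgρ
  refine ⟨fun y => ∑ᶠ i, ρ i (p y) * f i y,
    continuous_finsum (fun i => ((ρ i).continuous.comp hpc).mul (hfc i)) hlf,
    fun y => finsum_nonneg fun i => hg0 i y, fun x => ?_, fun K hK => ?_⟩
  · obtain ⟨i, hi⟩ := ρ.exists_pos (Set.mem_univ x)
    obtain ⟨y, hy, rfl⟩ := hρ i (subset_tsupport _ hi.ne')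
    refine ⟨y, rfl, (finsum_pos (fun j => hg0 j y)
      ⟨i, (hg0 i y).lt_of_ne' (mul_ne_zero hi.ne' hy)⟩ (hlf.point_finite y)).ne'⟩
  · have hfin := ρ.locallyFinite_tsupport.finite_nonempty_inter_compact hK
    refine (hfin.isCompact_biUnion fun i _ => hfs i).of_isClosed_subset
      ((hK.isClosed.preimage hpc).inter (isClosed_tsupport _)) ?_
    rintro y ⟨hyK, hy⟩
    obtain ⟨i, hi⟩ := Set.mem_iUnion.1 (hlf.tsupport_finsum_subset hy)
    have hpy : p y ∈ tsupport (ρ i) :=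
      closure_minimal ((hgρ i).trans (Set.preimage_mono (subset_tsupport _)))
        ((isClosed_tsupport _).preimage hpc) hi
    exact Set.mem_biUnion (show i ∈ {i | (tsupport (ρ i) ∩ K).Nonempty} from ⟨p y, hpy, hyK⟩)
      (closure_mono (fun z hz => right_ne_zero_of_mul hz) hi)
end

section
/- Let G be a group acting measurably on measurable spaces X and Y, let π : X → Y be measurable and equivariant (π(g•x) = g•π(x)), let μ be a σ-finite measure on Y, and let (ρ_y)_{y∈Y} be a measurable family of σ-finite measures on X (a kernel: y ↦ ρ_y(A) is measurable for each measurable A) such that ρ_y is concentrated on π⁻¹({y}) for every y (ρ_y(X \ π⁻¹({y})) = 0). Let Δ_Y : G × Y → (0,∞) and δ : G × X → (0,∞) be measurable, and assume that for every g ∈ G: the pushforward of μ under y ↦ g•y equals the measure with density Δ_Y(g,·) with respect to μ, and for every y ∈ Y the pushforward of ρ_y under x ↦ g•x equals the measure with density δ(g,·) with respect to ρ_{g•y}. Then the measure ν on X defined by ν(A) = ∫_Y ρ_y(A) dμ(y) satisfies: for every g ∈ G, the pushforward of ν under x ↦ g•x equals the measure with density x ↦ δ(g, x)·Δ_Y(g,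 π(x)) with respect to ν. -/
open MeasureTheory

/-- Proposition 3.2(ii) of the paper, for group actions with pointwise
hypotheses. If the base measure `μ` is quasi-invariant with module `ΔY` and the
disintegrating kernel `ρ` transforms with cocycle `δ`, then the glued measure
`ν(A) = ∫ ρ_y(A) dμ(y)` is quasi-invariant with module `(g, x) ↦ δ g x * ΔY g (p x)`. -/
theorem statement7 {G X Y : Type*} [Group G]
    [MeasurableSpace X] [MeasurableSpace Y]
    [MulAction G X] [MulAction G Y]
    (hmX : ∀ g : G, Measurable (fun x : X => g • x))
    (hmY : ∀ g : G, Measurable (fun y : Y => g • y))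
    (p : X → Y) (hp : Measurable p) (hpe : ∀ (g : G) (x : X), p (g • x) = g • p x)
    (μ : Measure Y) [SigmaFinite μ]
    (ρ : Y → Measure X)
    (hρmeas : ∀ A : Set X, MeasurableSet A → Measurable (fun y : Y => ρ y A))
    (hρsf : ∀ y : Y, SigmaFinite (ρ y))
    (hρconc : ∀ y : Y, ρ y ((p ⁻¹' {y})ᶜ) = 0)
    (ΔY : G → Y → ℝ) (δ : G → X → ℝ)
    (hΔYm : ∀ g : G, Measurable (ΔY g)) (hδm : ∀ g : G, Measurable (δ g))
    (hΔYpos : ∀ (g : G) (y : Y), 0 < ΔY g y) (hδpos : ∀ (g : G) (x : X), 0 < δ g x)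
    (hμqi : ∀ g : G, Measure.map (fun y : Y => g • y) μ =
      μ.withDensity (fun y => ENNReal.ofReal (ΔY g y)))
    (hρqi : ∀ (g : G) (y : Y), Measure.map (fun x : X => g • x) (ρ y) =
      (ρ (g • y)).withDensity (fun x => ENNReal.ofReal (δ g x)))
    (ν : Measure X) (hν : ∀ A : Set X, MeasurableSet A → ν A = ∫⁻ y, ρ y A ∂μ) :
    ∀ g : G, Measure.map (fun x : X => g • x) ν =
      ν.withDensity (fun x => ENNReal.ofReal (δ g x * ΔY g (p x))) := by
  intro g
  have hρ : Measurable ρ := Measure.measurable_of_measurable_coe ρ hρmeas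
  have hν_bind : ν = μ.bind ρ := by
    ext A hA
    rw [hν A hA, Measure.bind_apply hA hρ.aemeasurable]
  have hδ : Measurable fun x => ENNReal.ofReal (δ g x) := (hδm g).ennreal_ofReal
  have hΔ : Measurable fun y => ENNReal.ofReal (ΔY g y) := (hΔYm g).ennreal_ofReal
  have hδΔ : Measurable fun x => ENNReal.ofReal (δ g x * ΔY g (p x)) :=
    ((hδm g).mul ((hΔYm g).comp hp)).ennreal_ofReal
  ext A hA
  have hF : Measurable fun y => ∫⁻ x in A, ENNReal.ofReal (δ g x) ∂ρ y := by
    simp_rw [← lintegral_indicator hA]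
    exact (Measure.measurable_lintegral (hδ.indicator hA)).comp hρ
  calc Measure.map (fun x : X => g • x) ν A
      = ∫⁻ y, ρ y ((fun x : X => g • x) ⁻¹' A) ∂μ := by
        rw [Measure.map_apply (hmX g) hA, hν _ (hmX g hA)]
    _ = ∫⁻ y, ∫⁻ x in A, ENNReal.ofReal (δ g x) ∂ρ (g • y) ∂μ := by
        refine lintegral_congr fun y => ?_
        rw [← Measure.map_apply (hmX g) hA, hρqi g y, withDensity_apply _ hA]
    _ = ∫⁻ y, ∫⁻ x in A, ENNReal.ofReal (δ g x) ∂ρ y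
          ∂(μ.withDensity fun y => ENNReal.ofReal (ΔY g y)) := by
        rw [← hμqi g, lintegral_map hF (hmY g)]
    _ = ∫⁻ y, ENNReal.ofReal (ΔY g y) * ∫⁻ x in A, ENNReal.ofReal (δ g x) ∂ρ y ∂μ :=
        lintegral_withDensity_eq_lintegral_mul _ hΔ hF
    _ = ∫⁻ y, ∫⁻ x in A, ENNReal.ofReal (δ g x * ΔY g (p x)) ∂ρ y ∂μ := by
        refine lintegral_congr fun y => ?_
        have hpy : ∀ᵐ x ∂ρ y, p x = y := hρconc y
        rw [← lintegral_const_mul _ hδ]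
        refine lintegral_congr_ae ?_
        filter_upwards [ae_restrict_of_ae hpy] with x hx
        rw [hx, mul_comm, ENNReal.ofReal_mul (hδpos g x).le]
    _ = (ν.withDensity fun x => ENNReal.ofReal (δ g x * ΔY g (p x))) A := by
        rw [withDensity_apply _ hA, hν_bind, ← lintegral_indicator hA,
          Measure.lintegral_bind hρ.aemeasurable (hδΔ.indicator hA).aemeasurable]
        simp_rw [lintegral_indicator hA]
end
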